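/- (Corollary 3.4) Under the hypotheses of Proposition 3.3 — i.e., ẋ(t) = f(x(t),u(t)), D_u g(x(t),u(t)) invertible, and u̇(t) = (D_u g(x(t),u(t)))⁻¹ ( α (r(t+T) − g(x(t),u(t))) + ṙ(t+T) − D_x g(x(t),u(t)) f(x(t),u(t)) + E₂(t) ) for all t ≥ 0, with η₂ := limsup_{t→∞} ‖E₂(t)‖ — let h : ℝ^n → ℝ^m be continuous, define the output y(t) := h(x(t)) and the prediction error E₁(t) := g(x(t),u(t)) − y(t+T), and set η₁ := limsup_{t→∞} ‖E₁(t)‖. Then limsup_{t→∞} ‖r(t+T) − y(t+T)‖ ≤ η₁ + η₂ / α. -/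

import Mathlib

open Filter Topology ENNReal

/-- A solution of `e' = -α e + w` forced by `‖w‖ ≤ c` decays exponentially up to `c / α`. -/
theorem norm_le_exp_add_of_hasDerivAt {E : Type*} [NormedAddCommGroup E] [NormedSpace ℝ E]
    {e w : ℝ → E} {α c t₀ : ℝ} (hα : 0 < α)
    (he : ∀ t, t₀ ≤ t → HasDerivAt e (-(α • e t) + w t) t)
    (hw : ∀ t, t₀ ≤ t → ‖w t‖ ≤ c) {t : ℝ} (ht : t₀ ≤ t) :
    ‖e t‖ ≤ Real.exp (-(α * (t - t₀))) * ‖e t₀‖ + c / α := by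
  have hc : 0 ≤ c := (norm_nonneg _).trans (hw t₀ le_rfl)
  have hexp : ∀ s, HasDerivAt (fun s => Real.exp (α * (s - t₀)))
      (α * Real.exp (α * (s - t₀))) s := fun s => by
    have h := (((hasDerivAt_id s).sub_const t₀).const_mul α).exp
    simpa [mul_comm] using h
  have hv : ∀ s, t₀ ≤ s → HasDerivAt (fun s => Real.exp (α * (s - t₀)) • e s)
      (Real.exp (α * (s - t₀)) • w s) s := fun s hs => by
    refine ((hexp s).smul (he s hs)).congr_deriv ?_
    module
  have hB : ∀ s, HasDerivAt (fun s => ‖e t₀‖ + c / α * (Real.exp (α * (s - t₀)) - 1))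
      (c * Real.exp (α * (s - t₀))) s := fun s => by
    refine ((((hexp s).sub_const 1).const_mul (c / α)).const_add ‖e t₀‖).congr_deriv ?_
    field_simp
  have key := image_norm_le_of_norm_deriv_right_le_deriv_boundary (a := t₀) (b := t)
    (fun s hs => (hv s hs.1).continuousAt.continuousWithinAt)
    (fun s hs => (hv s hs.1).hasDerivWithinAt) (by simp) hB
    (fun s hs => by
      rw [norm_smul, Real.norm_of_nonneg (Real.exp_pos _).le, mul_comm]
      exact mul_le_mul_of_nonneg_right (hw s hs.1) (Real.exp_pos _).le)
    (Set.right_mem_Icc.2 ht)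
  rw [norm_smul, Real.norm_of_nonneg (Real.exp_pos _).le] at key
  have hcα : 0 ≤ c / α := by positivity
  rw [Real.exp_neg, ← div_eq_inv_mul, ← sub_le_iff_le_add, le_div_iff₀ (Real.exp_pos _)]
  linarith

/-- The asymptotic gain of `e' = -α e + w` from `w` to `e` is at most `1 / α`. -/
theorem limsup_nnnorm_le_div_of_hasDerivAt {E : Type*} [NormedAddCommGroup E] [NormedSpace ℝ E]
    {e w : ℝ → E} {α t₀ : ℝ} (hα : 0 < α)
    (he : ∀ t, t₀ ≤ t → HasDerivAt e (-(α • e t) + w t) t) :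
    limsup (fun t => (‖e t‖₊ : ℝ≥0∞)) atTop ≤
      limsup (fun t => (‖w t‖₊ : ℝ≥0∞)) atTop / ENNReal.ofReal α := by
  have hα' : ENNReal.ofReal α ≠ 0 := by simpa using hα
  rw [ENNReal.le_div_iff_mul_le (.inl hα') (.inl ofReal_ne_top)]
  refine le_of_forall_gt_imp_ge_of_dense fun c hc => ?_
  rcases eq_or_ne c ⊤ with rfl | hctop
  · exact le_top
  rw [← ENNReal.le_div_iff_mul_le (.inl hα') (.inl ofReal_ne_top)]
  obtain ⟨t₁, ht₁⟩ := eventually_atTop.1 (eventually_lt_of_limsup_lt hc)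
  have hbound : ∀ t, max t₀ t₁ ≤ t → ‖e t‖ ≤
      Real.exp (-(α * (t - max t₀ t₁))) * ‖e (max t₀ t₁)‖ + c.toReal / α := fun t ht =>
    norm_le_exp_add_of_hasDerivAt hα (fun s hs => he s ((le_max_left _ _).trans hs))
      (fun s hs => by
        simpa using ENNReal.toReal_mono hctop (ht₁ s ((le_max_right _ _).trans hs)).le) ht
  have hlim : Tendsto (fun t => Real.exp (-(α * (t - max t₀ t₁))) * ‖e (max t₀ t₁)‖
      + c.toReal / α) atTop (𝓝 (c.toReal / α)) := by
    have h : Tendsto (fun t => Real.exp (-(α * (t - max t₀ t₁)))) atTop (𝓝 0) :=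
      Real.tendsto_exp_neg_atTop_nhds_zero.comp
        ((tendsto_atTop_add_const_right _ (-max t₀ t₁) tendsto_id).const_mul_atTop hα)
    simpa using (h.mul_const ‖e (max t₀ t₁)‖).add_const (c.toReal / α)
  calc limsup (fun t => (‖e t‖₊ : ℝ≥0∞)) atTop
      ≤ limsup (fun t => ENNReal.ofReal (Real.exp (-(α * (t - max t₀ t₁))) * ‖e (max t₀ t₁)‖
          + c.toReal / α)) atTop := by
        refine limsup_le_limsup ?_
        filter_upwards [eventually_ge_atTop (max t₀ t₁)] with t ht
        rw [← enorm_eq_nnnorm, ← ofReal_norm]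
        exact ENNReal.ofReal_le_ofReal (hbound t ht)
    _ = ENNReal.ofReal (c.toReal / α) := (ENNReal.tendsto_ofReal hlim).limsup_eq
    _ = c / ENNReal.ofReal α := by
        rw [ENNReal.ofReal_div_of_pos hα, ENNReal.ofReal_toReal hctop]

/-- Subadditivity of `limsup` in `ℝ≥0∞` along an arbitrary filter. -/
theorem ENNReal.limsup_add_le_add_limsup {ι : Type*} {l : Filter ι} (v w : ι → ℝ≥0∞) :
    limsup (v + w) l ≤ limsup v l + limsup w l := by
  refine ENNReal.le_of_forall_pos_le_add fun ε hε hfin => ?_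
  obtain ⟨hv, hw⟩ := ENNReal.add_lt_top.1 hfin
  have hε' : (ε / 2 : ℝ≥0∞) ≠ 0 := by simpa using hε.ne'
  have hle : limsup (v + w) l ≤ (limsup v l + ε / 2) + (limsup w l + ε / 2) := by
    refine limsup_le_of_le (by isBoundedDefault) ?_
    filter_upwards [eventually_lt_of_limsup_lt (ENNReal.lt_add_right hv.ne hε'),
      eventually_lt_of_limsup_lt (ENNReal.lt_add_right hw.ne hε')] with i hvi hwi
    exact add_le_add hvi.le hwi.le
  rwa [add_add_add_comm, ENNReal.add_halves] at hle

/-- Chain rule along a curve, written with the two partial derivatives. -/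
theorem HasDerivAt.comp_prodMk_partial {E F G : Type*} [NormedAddCommGroup E] [NormedSpace ℝ E]
    [NormedAddCommGroup F] [NormedSpace ℝ F] [NormedAddCommGroup G] [NormedSpace ℝ G]
    {g : E × F → G} {x : ℝ → E} {u : ℝ → F} {x' : E} {u' : F} {t : ℝ}
    (hg : DifferentiableAt ℝ g (x t, u t)) (hx : HasDerivAt x x' t) (hu : HasDerivAt u u' t) :
    HasDerivAt (fun s => g (x s, u s))
      (fderiv ℝ (fun a => g (a, u t)) (x t) x' + fderiv ℝ (fun b => g (x t, b)) (u t) u') t := by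
  have hl := (hg.hasFDerivAt.comp (x t) (hasFDerivAt_prodMk_left (𝕜 := ℝ) (x t) (u t))).fderiv
  have hr := (hg.hasFDerivAt.comp (u t) (hasFDerivAt_prodMk_right (𝕜 := ℝ) (x t) (u t))).fderiv
  simp only [Function.comp_def] at hl hr
  refine (hg.hasFDerivAt.comp_hasDerivAt t (hx.prodMk hu)).congr_deriv ?_
  rw [hl, hr]
  simp [← map_add]

/-- Corollary 3.4: under the hypotheses of Proposition 3.3, with output
`y(t) = h(x(t))` and prediction error `E₁(t) = ŷ(t+T) − y(t+T)`, the
asymptotic tracking error is bounded by `η₁ + η₂/α`. -/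
theorem speedup_controller_asymptotic_tracking_error_bound
    (n m : ℕ) (hn : 1 ≤ n) (hm : 1 ≤ m)
    (f : EuclideanSpace ℝ (Fin n) × EuclideanSpace ℝ (Fin m) → EuclideanSpace ℝ (Fin n))
    (hf : Continuous f)
    (h : EuclideanSpace ℝ (Fin n) → EuclideanSpace ℝ (Fin m))
    (hh : Continuous h)
    (g : EuclideanSpace ℝ (Fin n) × EuclideanSpace ℝ (Fin m) → EuclideanSpace ℝ (Fin m))
    (hg : ContDiff ℝ 1 g)
    (r : ℝ → EuclideanSpace ℝ (Fin m))
    (hr : Differentiable ℝ r)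
    (T : ℝ) (hT : 0 < T)
    (α : ℝ) (hα : 0 < α)
    (E₂ : ℝ → EuclideanSpace ℝ (Fin m))
    (hE₂ : Continuous E₂)
    (x : ℝ → EuclideanSpace ℝ (Fin n))
    (u : ℝ → EuclideanSpace ℝ (Fin m))
    (hx : ∀ t : ℝ, 0 ≤ t → HasDerivAt x (f (x t, u t)) t)
    (hu : ∀ t : ℝ, 0 ≤ t →
      ∃ J : EuclideanSpace ℝ (Fin m) ≃L[ℝ] EuclideanSpace ℝ (Fin m),
        (J : EuclideanSpace ℝ (Fin m) →L[ℝ] EuclideanSpace ℝ (Fin m)) =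
          fderiv ℝ (fun u' => g (x t, u')) (u t) ∧
        HasDerivAt u
          (J.symm (α • (r (t + T) - g (x t, u t)) + deriv r (t + T) -
            (fderiv ℝ (fun x' => g (x', u t)) (x t)) (f (x t, u t)) + E₂ t)) t) :
    Filter.limsup (fun t => (‖r (t + T) - h (x (t + T))‖₊ : ℝ≥0∞)) Filter.atTop ≤
      Filter.limsup (fun t => (‖g (x t, u t) - h (x (t + T))‖₊ : ℝ≥0∞)) Filter.atTop +
        (Filter.limsup (fun t => (‖E₂ t‖₊ : ℝ≥0∞)) Filter.atTop) / ENNReal.ofReal α := by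
  have he : ∀ t, 0 ≤ t → HasDerivAt (fun t => r (t + T) - g (x t, u t))
      (-(α • (r (t + T) - g (x t, u t))) + -E₂ t) t := fun t ht => by
    obtain ⟨J, hJ, hut⟩ := hu t ht
    have hgt := HasDerivAt.comp_prodMk_partial
      (hg.differentiable one_ne_zero).differentiableAt (hx t ht) hut
    rw [← hJ] at hgt
    refine (((hr (t + T)).hasDerivAt.comp_add_const t T).sub hgt).congr_deriv ?_
    simp only [ContinuousLinearEquiv.coe_coe, ContinuousLinearEquiv.apply_symm_apply]
    abel
  calc limsup (fun t => (‖r (t + T) - h (x (t + T))‖₊ : ℝ≥0∞)) atTop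
      ≤ limsup ((fun t => (‖g (x t, u t) - h (x (t + T))‖₊ : ℝ≥0∞)) +
          fun t => (‖r (t + T) - g (x t, u t)‖₊ : ℝ≥0∞)) atTop := by
        refine limsup_le_limsup (.of_forall fun t => ?_)
        simpa [enorm_eq_nnnorm, add_comm] using
          enorm_add_le (r (t + T) - g (x t, u t)) (g (x t, u t) - h (x (t + T)))
    _ ≤ _ := ENNReal.limsup_add_le_add_limsup _ _
    _ ≤ _ := by
        gcongr
        simpa only [nnnorm_neg] using limsup_nnnorm_le_div_of_hasDerivAt hα he
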